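/- Let P be a free program, M ⊆ σ_P a set of atoms, and M_S = M ∪ φ(S \ M). Then FreeGen(P) ∪ {¬a : a ∈ σ_{FreeGen(P)} \ M_S} ∪ {¬¬a : a ∈ M_S} ⊩_I M_S if and only if P ∪ {¬a : a ∈ σ_P \ M} ∪ {¬¬a : a ∈ M} ⊩_I M. -/

import Mathlib

namespace ASP

/-- Propositional formulas over atoms `α`, built with ∧, ∨, ← and ⊥.
`impl A B` denotes the formula `B ← A` (i.e. `A → B`). -/
inductive PropForm (α : Type) : Type
  | var : α → PropForm α
  | fals : PropForm α
  | conj : PropForm α → PropForm α → PropForm α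
  | disj : PropForm α → PropForm α → PropForm α
  | impl : PropForm α → PropForm α → PropForm α
  deriving DecidableEq

namespace PropForm

variable {α : Type}

/-- `¬F` abbreviates `⊥ ← F`. -/
def neg (A : PropForm α) : PropForm α := impl A fals

/-- `⊤` abbreviates `⊥ ← ⊥`. -/
def top : PropForm α := impl fals fals

/-- The set of atoms occurring in a formula. -/
def atoms : PropForm α → Set α
  | var a => {a}
  | fals => ∅
  | conj A B => atoms A ∪ atoms B
  | disj A B => atoms A ∪ atoms B
  | impl A B => atoms A ∪ atoms B

end PropForm

open PropForm

/-- Hilbert-style derivability for intuitionistic propositional logic,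
with an extra set `Ax` of additional axioms. -/
inductive Deriv {α : Type} (Ax : Set (PropForm α)) : PropForm α → Prop
  | ax {A} : A ∈ Ax → Deriv Ax A
  | k (A B) : Deriv Ax (impl A (impl B A))
  | s (A B C) : Deriv Ax (impl (impl A (impl B C)) (impl (impl A B) (impl A C)))
  | conjIntro (A B) : Deriv Ax (impl A (impl B (conj A B)))
  | conjElimL (A B) : Deriv Ax (impl (conj A B) A)
  | conjElimR (A B) : Deriv Ax (impl (conj A B) B)
  | disjIntroL (A B) : Deriv Ax (impl A (disj A B))
  | disjIntroR (A B) : Deriv Ax (impl B (disj A B))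
  | disjElim (A B C) : Deriv Ax (impl (impl A C) (impl (impl B C) (impl (disj A B) C)))
  | falsElim (A) : Deriv Ax (impl fals A)
  | mp {A B} : Deriv Ax (impl A B) → Deriv Ax A → Deriv Ax B

/-- `F` is a theorem of intuitionistic propositional logic. -/
def IThm {α : Type} (F : PropForm α) : Prop := Deriv ∅ F

/-- `F` is a theorem of classical propositional logic
(intuitionistic logic plus double-negation elimination). -/
def CThm {α : Type} (F : PropForm α) : Prop :=
  Deriv {F | ∃ A, F = impl (neg (neg A)) A} F

/-- Conjunction of a finite list of formulas (empty conjunction is ⊤). -/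
def bigConj {α : Type} : List (PropForm α) → PropForm α
  | [] => top
  | [A] => A
  | A :: L => conj A (bigConj L)

/-- Disjunction of a finite list of formulas (empty disjunction is ⊥). -/
def bigDisj {α : Type} : List (PropForm α) → PropForm α
  | [] => fals
  | [A] => A
  | A :: L => disj A (bigDisj L)

/-- `T ⊢_X F`: the formula `F ← (F₁ ∧ ... ∧ Fₙ)` is a theorem of the logic
whose theorems are `Thm`, for some `F₁, ..., Fₙ ∈ T`. -/
def ProvesFrom {α : Type} (Thm : PropForm α → Prop) (T : Set (PropForm α))
    (F : PropForm α) : Prop :=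
  ∃ L : List (PropForm α), (∀ G ∈ L, G ∈ T) ∧ Thm (impl (bigConj L) F)

/-- `T ⊢_I F`. -/
def IProves {α : Type} (T : Set (PropForm α)) (F : PropForm α) : Prop :=
  ProvesFrom IThm T F

/-- `T ⊢_C F`. -/
def CProves {α : Type} (T : Set (PropForm α)) (F : PropForm α) : Prop :=
  ProvesFrom CThm T F

/-- `T` is consistent in intuitionistic logic. -/
def IConsistent {α : Type} (T : Set (PropForm α)) : Prop := ¬ IProves T fals

/-- `T ⊩_I M`: `T` is consistent and proves (intuitionistically) every atom of `M`. -/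
def IProvesAll {α : Type} (T : Set (PropForm α)) (M : Set α) : Prop :=
  IConsistent T ∧ ∀ a ∈ M, IProves T (var a)

/-- `T ≡_I U`: the two theories prove each other's formulas intuitionistically. -/
def IEquivTh {α : Type} (T U : Set (PropForm α)) : Prop :=
  (∀ F ∈ U, IProves T F) ∧ (∀ F ∈ T, IProves U F)

/-- The signature (set of occurring atoms) of a theory. -/
def sigTh {α : Type} (T : Set (PropForm α)) : Set α := ⋃ F ∈ T, F.atoms

/-- `T` is (literal) complete: for every atom `a` of its signature,
`T ⊢_I a` or `T ⊢_I ¬a`. -/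
def IComplete {α : Type} (T : Set (PropForm α)) : Prop :=
  ∀ a ∈ sigTh T, IProves T (var a) ∨ IProves T (neg (var a))

/-- `{¬a : a ∈ S}`. -/
def negSet {α : Type} (S : Set α) : Set (PropForm α) := (fun a => neg (var a)) '' S

/-- `{¬¬a : a ∈ S}`. -/
def negnegSet {α : Type} (S : Set α) : Set (PropForm α) :=
  (fun a => neg (neg (var a))) '' S

/-- Classical two-valued satisfaction, identifying an interpretation with the
set of atoms it makes true. -/
def sat2 {α : Type} (X : Set α) : PropForm α → Prop
  | .var a => a ∈ X
  | .fals => False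
  | .conj A B => sat2 X A ∧ sat2 X B
  | .disj A B => sat2 X A ∨ sat2 X B
  | .impl A B => sat2 X A → sat2 X B

/-- `X` is a classical model of the theory `T`. -/
def isModel2 {α : Type} (X : Set α) (T : Set (PropForm α)) : Prop := ∀ F ∈ T, sat2 X F

/-- `M` is a minimal (under ⊆) classical model of `T`. -/
def isMinModel {α : Type} (T : Set (PropForm α)) (M : Set α) : Prop :=
  isModel2 M T ∧ ∀ N ⊆ M, isModel2 N T → N = M

/-- Evaluation in the 3-valued Gödel logic G3. -/
def g3 {α : Type} (I : α → Fin 3) : PropForm α → Fin 3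
  | .var a => I a
  | .fals => 0
  | .conj A B => min (g3 I A) (g3 I B)
  | .disj A B => max (g3 I A) (g3 I B)
  | .impl A B => if g3 I A ≤ g3 I B then 2 else g3 I B

/-- Nested formulas: built from atoms, ⊤ and ⊥ using ∧, ∨ and ¬. -/
inductive NF (α : Type) : Type
  | var : α → NF α
  | top : NF α
  | bot : NF α
  | conj : NF α → NF α → NF α
  | disj : NF α → NF α → NF α
  | neg : NF α → NF α
  deriving DecidableEq

namespace NF

variable {α : Type}

/-- Reading a nested formula as a propositional formula
(`⊤ = ⊥ ← ⊥` and `¬F = ⊥ ← F`). -/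
def toProp : NF α → PropForm α
  | var a => .var a
  | top => PropForm.top
  | bot => .fals
  | conj A B => .conj (toProp A) (toProp B)
  | disj A B => .disj (toProp A) (toProp B)
  | neg A => PropForm.neg (toProp A)

/-- Atoms occurring in a nested formula. -/
def atoms : NF α → Set α
  | var a => {a}
  | top => ∅
  | bot => ∅
  | conj A B => atoms A ∪ atoms B
  | disj A B => atoms A ∪ atoms B
  | neg A => atoms A

/-- Satisfaction of a (basic, negation-free) nested formula by a set of atoms. -/
def satB (X : Set α) : NF α → Prop
  | var a => a ∈ X
  | top => True
  | bot => False
  | conj A B => satB X A ∧ satB X B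
  | disj A B => satB X A ∨ satB X B
  | neg A => ¬ satB X A

open scoped Classical in
/-- The reduct `F^X`: each maximal subformula `¬G` is replaced by ⊥ if
`X ⊨ G^X` and by ⊤ otherwise. -/
noncomputable def reduct (X : Set α) : NF α → NF α
  | var a => var a
  | top => top
  | bot => bot
  | conj A B => conj (reduct X A) (reduct X B)
  | disj A B => disj (reduct X A) (reduct X B)
  | neg A => if satB X (reduct X A) then bot else top

end NF

/-- An augmented clause `H ← B` is a pair `(H, B)` of nested formulas. -/
abbrev AugClause (α : Type) := NF α × NF α

/-- The propositional formula `H ← B` of an augmented clause. -/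
def clauseToProp {α : Type} (c : AugClause α) : PropForm α :=
  .impl c.2.toProp c.1.toProp

/-- The theory of an augmented program. -/
def progTh {α : Type} (P : List (AugClause α)) : Set (PropForm α) :=
  {F | ∃ c ∈ P, clauseToProp c = F}

/-- The signature of an augmented program. -/
def progSig {α : Type} (P : List (AugClause α)) : Set α :=
  {a | ∃ c ∈ P, a ∈ c.1.atoms ∪ c.2.atoms}

/-- `X` is closed under the (basic) program `P`: for each clause `H ← B`,
`X ⊨ H` whenever `X ⊨ B`. -/
def closedUnder {α : Type} (X : Set α) (P : List (AugClause α)) : Prop :=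
  ∀ c ∈ P, NF.satB X c.2 → NF.satB X c.1

/-- The reduct `P^X` of an augmented program. -/
noncomputable def progReduct {α : Type} (X : Set α) (P : List (AugClause α)) :
    List (AugClause α) :=
  P.map fun c => (c.1.reduct X, c.2.reduct X)

/-- `M` is an answer set of `P`: `M` is minimal (under ⊆) among the sets of
atoms closed under the reduct `P^M`. -/
def isAnswerSet {α : Type} (P : List (AugClause α)) (M : Set α) : Prop :=
  closedUnder M (progReduct M P) ∧ ∀ N ⊆ M, closedUnder N (progReduct M P) → N = M

/-- `M` is a min-answer set of `P`: both an answer set and a minimal model. -/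
def isMinAnswerSet {α : Type} (P : List (AugClause α)) (M : Set α) : Prop :=
  isAnswerSet P M ∧ isMinModel (progTh P) M

/-- A G3 interpretation models an augmented program. -/
def g3ModelsProg {α : Type} (I : α → Fin 3) (P : List (AugClause α)) : Prop :=
  ∀ c ∈ P, g3 I (clauseToProp c) = 2

/-- A free clause: a list of head literals and a list of body literals,
a literal being an atom `(a, true)` or a negated atom `(a, false)`.
It denotes `h₁ ∨ ... ∨ hₙ ← b₁ ∧ ... ∧ bₘ` (empty head = ⊥, empty body = ⊤). -/
structure FClause (α : Type) where
  head : List (α × Bool)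
  body : List (α × Bool)
  deriving DecidableEq

/-- The propositional formula of a literal. -/
def litToProp {α : Type} : α × Bool → PropForm α
  | (a, true) => .var a
  | (a, false) => PropForm.neg (.var a)

/-- The nested formula of a literal. -/
def litToNF {α : Type} : α × Bool → NF α
  | (a, true) => .var a
  | (a, false) => .neg (.var a)

/-- Disjunction of a list of nested formulas (empty = ⊥). -/
def bigDisjNF {α : Type} : List (NF α) → NF α
  | [] => .bot
  | [A] => A
  | A :: L => .disj A (bigDisjNF L)

/-- Conjunction of a list of nested formulas (empty = ⊤). -/
def bigConjNF {α : Type} : List (NF α) → NF α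
  | [] => .top
  | [A] => A
  | A :: L => .conj A (bigConjNF L)

namespace FClause

variable {α : Type}

/-- The propositional formula of a free clause. -/
def toProp (c : FClause α) : PropForm α :=
  .impl (bigConj (c.body.map litToProp)) (bigDisj (c.head.map litToProp))

/-- A free clause as an augmented clause. -/
def toAug (c : FClause α) : AugClause α :=
  (bigDisjNF (c.head.map litToNF), bigConjNF (c.body.map litToNF))

/-- The atoms of a free clause. -/
def atomsF (c : FClause α) : Set α :=
  {a | (∃ b, (a, b) ∈ c.head) ∨ (∃ b, (a, b) ∈ c.body)}

/-- A general clause: all head literals are positive atoms. -/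
def isGeneral (c : FClause α) : Prop := ∀ l ∈ c.head, l.2 = true

/-- A disjunctive clause: a general clause with nonempty head. -/
def isDisjunctive (c : FClause α) : Prop := c.isGeneral ∧ c.head ≠ []

/-- A constraint: a clause with empty head (head ⊥). -/
def isConstraint (c : FClause α) : Prop := c.head = []

end FClause

/-- The theory of a free program. -/
def fTh {α : Type} (P : List (FClause α)) : Set (PropForm α) :=
  {F | ∃ c ∈ P, c.toProp = F}

/-- The signature of a free program. -/
def fSig {α : Type} (P : List (FClause α)) : Set α :=
  {a | ∃ c ∈ P, a ∈ c.atomsF}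

/-- `GenDisj(P)`: each constraint `⊥ ← B` is replaced by `p ← B ∧ ¬p`,
where `p` is a new reserved atom. -/
def genDisj {α : Type} [DecidableEq α] (P : List (FClause α)) (p : α) :
    List (FClause α) :=
  P.map fun c =>
    if c.head = [] then ⟨[(p, true)], c.body ++ [(p, false)]⟩ else c

/-- The atoms `a` such that `¬a` occurs in the head of some clause of `P`
(the set `S` of the FreeGen transformation), as a list. -/
def headNegs {α : Type} (P : List (FClause α)) : List α :=
  P.flatMap fun c => c.head.filterMap fun l => if l.2 = false then some l.1 else none

open scoped Classical in
/-- Replace the occurrence of `¬a` (for `a ∈ S`) by the positive atom `φ a`. -/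
noncomputable def substLit {α : Type} (S : Set α) (φ : α → α) (l : α × Bool) :
    α × Bool :=
  if l.2 = false ∧ l.1 ∈ S then (φ l.1, true) else l

/-- Replace every occurrence of `¬a` (for `a ∈ S`) by `φ a` in a clause. -/
noncomputable def FClause.subst {α : Type} (S : Set α) (φ : α → α) (c : FClause α) :
    FClause α :=
  ⟨c.head.map (substLit S φ), c.body.map (substLit S φ)⟩

/-- `Δ_S = ⋃_{a ∈ S} {φ(a) ← ¬a, ⊥ ← a ∧ φ(a)}`. -/
def deltaClauses {α : Type} (L : List α) (φ : α → α) : List (FClause α) :=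
  L.flatMap fun a => [⟨[(φ a, true)], [(a, false)]⟩, ⟨[], [(a, true), (φ a, true)]⟩]

/-- `FreeGen(P) = P' ∪ Δ_S`. -/
noncomputable def freeGen {α : Type} (P : List (FClause α)) (φ : α → α) :
    List (FClause α) :=
  P.map (FClause.subst {a | a ∈ headNegs P} φ) ++ deltaClauses (headNegs P) φ

open scoped Classical in
/-- The second reduction `redu2(P; ¬¬M)`: clauses whose body contains a literal
`¬a` with `a ∈ M` are deleted; in constraints, positive body literals `a ∈ M`
are deleted. -/
noncomputable def redu2 {α : Type} [DecidableEq α] (P : List (FClause α))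
    (M : Set α) : List (FClause α) :=
  (P.filter fun c => decide (¬ ∃ l ∈ c.body, l.2 = false ∧ l.1 ∈ M)).map
    fun c =>
      if c.head = [] then
        ⟨[], c.body.filter fun l => decide (¬ (l.2 = true ∧ l.1 ∈ M))⟩
      else c

/-- `P₂` is a conservative extension of `P₁`: `M₁` is an answer set of `P₁`
iff `M₂` is an answer set of `P₂`, where `M₁ = M₂ ∩ σ_{P₁}`. -/
def consExt {α : Type} (P1 P2 : List (AugClause α)) : Prop :=
  (∀ M2 : Set α, isAnswerSet P2 M2 → isAnswerSet P1 (M2 ∩ progSig P1)) ∧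
  (∀ M1 : Set α, isAnswerSet P1 M1 →
    ∃ M2 : Set α, isAnswerSet P2 M2 ∧ M1 = M2 ∩ progSig P1)

/-- `P₂` is a strong conservative extension of the user program `P₁` (relative
to the user signature `U`): for every user program `P`, `P₂ ∪ P` is a
conservative extension of `P₁ ∪ P`. -/
def strongConsExt {α : Type} (P1 P2 : List (AugClause α)) (U : Set α) : Prop :=
  ∀ P : List (AugClause α), progSig P ⊆ U → consExt (P1 ++ P) (P2 ++ P)

mutual
  /-- Negation normal form: push negations inward (no pending negation). -/
  def nnf0 {α : Type} : NF α → NF α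
    | .var a => .var a
    | .top => .top
    | .bot => .bot
    | .conj A B => .conj (nnf0 A) (nnf0 B)
    | .disj A B => .disj (nnf0 A) (nnf0 B)
    | .neg A => nnf1 A
  /-- Negation normal form under one pending negation. -/
  def nnf1 {α : Type} : NF α → NF α
    | .var a => .neg (.var a)
    | .top => .bot
    | .bot => .top
    | .conj A B => .disj (nnf1 A) (nnf1 B)
    | .disj A B => .conj (nnf1 A) (nnf1 B)
    | .neg A => nnf2 A
  /-- Negation normal form under two pending negations. -/
  def nnf2 {α : Type} : NF α → NF α
    | .var a => .neg (.neg (.var a))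
    | .top => .top
    | .bot => .bot
    | .conj A B => .conj (nnf2 A) (nnf2 B)
    | .disj A B => .disj (nnf2 A) (nnf2 B)
    | .neg A => nnf1 A
end

/-- Conjunctive normal form (list of disjunction-lists of leaves). -/
def cnfNF {α : Type} : NF α → List (List (NF α))
  | .conj A B => cnfNF A ++ cnfNF B
  | .disj A B => (cnfNF A).flatMap fun c => (cnfNF B).map fun d => c ++ d
  | F => [[F]]

/-- Disjunctive normal form (list of conjunction-lists of leaves). -/
def dnfNF {α : Type} : NF α → List (List (NF α))
  | .disj A B => dnfNF A ++ dnfNF B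
  | .conj A B => (dnfNF A).flatMap fun c => (dnfNF B).map fun d => c ++ d
  | F => [[F]]

/-- Read a leaf as a literal (if it is one). -/
def leafLit {α : Type} : NF α → Option (α × Bool)
  | .var a => some (a, true)
  | .neg (.var a) => some (a, false)
  | _ => none

/-- Read a leaf `¬¬a` as the literal `¬a` to be moved to the other side. -/
def dnegLit {α : Type} : NF α → Option (α × Bool)
  | .neg (.neg (.var a)) => some (a, false)
  | _ => none

/-- Build a free clause from a head disjunct-list and a body conjunct-list:
doubly negated atoms `¬¬a` in the head become `¬a` in the body and vice versa;
trivial clauses (⊤ in the head or ⊥ in the body) are removed. -/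
def procClause {α : Type} [DecidableEq α] (hd bd : List (NF α)) :
    Option (FClause α) :=
  if NF.top ∈ hd ∨ NF.bot ∈ bd then none
  else some ⟨hd.filterMap leafLit ++ bd.filterMap dnegLit,
             bd.filterMap leafLit ++ hd.filterMap dnegLit⟩

/-- `AugFree(P)`: the free program obtained from the augmented program `P` by
pushing negations inward, taking CNF of heads and DNF of bodies, splitting
conjunctions in heads and disjunctions in bodies into separate clauses, and
eliminating doubly negated atoms. -/
def augFree {α : Type} [DecidableEq α] (P : List (AugClause α)) :
    List (FClause α) :=
  P.flatMap fun c =>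
    (cnfNF (nnf0 c.1)).flatMap fun hd =>
      (dnfNF (nnf0 c.2)).filterMap fun bd => procClause hd bd

/-- Positive formulas: no negation (in particular no ⊥) occurs. -/
def IsPositive {α : Type} : PropForm α → Prop
  | .var _ => True
  | .fals => False
  | .conj A B => IsPositive A ∧ IsPositive B
  | .disj A B => IsPositive A ∧ IsPositive B
  | .impl A B => IsPositive A ∧ IsPositive B

/-- The set 𝐍 of two-negated formulas. -/
inductive IsTwoNeg {α : Type} : PropForm α → Prop
  | atom (a : α) : IsTwoNeg (neg (neg (var a)))
  | dneg {A} : IsTwoNeg A → IsTwoNeg (neg (neg A))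
  | conj {A B} : IsTwoNeg A → IsTwoNeg B → IsTwoNeg (PropForm.conj A B)
  | disjL {A} (B) : IsTwoNeg A → IsTwoNeg (PropForm.disj A B)
  | disjR {A} (B) : IsTwoNeg A → IsTwoNeg (PropForm.disj B A)
  | himp {A} (B) : IsTwoNeg A → IsTwoNeg (PropForm.impl B A)

namespace Deriv

variable {α : Type} {T U : Set (PropForm α)} {A B C F : PropForm α}

theorem weaken (h : Deriv T B) : Deriv T (impl A B) := mp (k B A) h

theorem id (A : PropForm α) : Deriv T (impl A A) :=
  mp (mp (s A (impl A A) A) (k _ _)) (k _ _)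

theorem trans (h₁ : Deriv T (impl A B)) (h₂ : Deriv T (impl B C)) : Deriv T (impl A C) :=
  mp (mp (s A B C) (weaken h₂)) h₁

/-- Cut: derivability is closed under replacing axioms by derivable formulas. -/
theorem cut (h : Deriv T F) (hT : ∀ G ∈ T, Deriv U G) : Deriv U F := by
  induction h with
  | ax h => exact hT _ h
  | mp _ _ ih₁ ih₂ => exact mp ih₁ ih₂
  | k => apply k
  | s => apply s
  | conjIntro => apply conjIntro
  | conjElimL => apply conjElimL
  | conjElimR => apply conjElimR
  | disjIntroL => apply disjIntroL
  | disjIntroR => apply disjIntroR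
  | disjElim => apply disjElim
  | falsElim => apply falsElim

theorem mono (h : Deriv T F) (hTU : T ⊆ U) : Deriv U F := h.cut fun _ hG => ax (hTU hG)

theorem deduction (h : Deriv (insert A T) F) : Deriv T (impl A F) := by
  induction h with
  | ax h =>
    rcases h with rfl | h
    · exact id _
    · exact weaken (ax h)
  | mp _ _ ih₁ ih₂ => exact mp (mp (s _ _ _) ih₁) ih₂
  | k => exact weaken (k _ _)
  | s => exact weaken (s _ _ _)
  | conjIntro => exact weaken (conjIntro _ _)
  | conjElimL => exact weaken (conjElimL _ _)
  | conjElimR => exact weaken (conjElimR _ _)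
  | disjIntroL => exact weaken (disjIntroL _ _)
  | disjIntroR => exact weaken (disjIntroR _ _)
  | disjElim => exact weaken (disjElim _ _ _)
  | falsElim => exact weaken (falsElim _)

theorem exists_list (h : Deriv T F) :
    ∃ L : List (PropForm α), (∀ G ∈ L, G ∈ T) ∧ Deriv {G | G ∈ L} F := by
  induction h with
  | @ax A h => exact ⟨[A], by simpa using h, ax (by simp)⟩
  | mp _ _ ih₁ ih₂ =>
    obtain ⟨L₁, hL₁, h₁⟩ := ih₁
    obtain ⟨L₂, hL₂, h₂⟩ := ih₂
    refine ⟨L₁ ++ L₂, fun G hG => (List.mem_append.1 hG).elim (hL₁ G) (hL₂ G), ?_⟩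
    exact mp (h₁.mono fun G hG => List.mem_append_left _ hG)
      (h₂.mono fun G hG => List.mem_append_right _ hG)
  | k => exact ⟨[], by simp, k _ _⟩
  | s => exact ⟨[], by simp, s _ _ _⟩
  | conjIntro => exact ⟨[], by simp, conjIntro _ _⟩
  | conjElimL => exact ⟨[], by simp, conjElimL _ _⟩
  | conjElimR => exact ⟨[], by simp, conjElimR _ _⟩
  | disjIntroL => exact ⟨[], by simp, disjIntroL _ _⟩
  | disjIntroR => exact ⟨[], by simp, disjIntroR _ _⟩
  | disjElim => exact ⟨[], by simp, disjElim _ _ _⟩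
  | falsElim => exact ⟨[], by simp, falsElim _⟩

theorem bigConj_elim {L : List (PropForm α)} {G : PropForm α} (hG : G ∈ L) :
    Deriv T (impl (bigConj L) G) := by
  induction L using bigConj.induct with
  | case1 => simp at hG
  | case2 A =>
    obtain rfl := List.mem_singleton.1 hG
    exact id _
  | case3 A L hL ih =>
    rw [bigConj.eq_3 _ _ hL]
    rcases List.mem_cons.1 hG with rfl | hG
    · exact conjElimL _ _
    · exact (conjElimR _ _).trans (ih hG)

theorem bigConj_intro {L : List (PropForm α)} (h : ∀ G ∈ L, Deriv T (impl C G)) :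
    Deriv T (impl C (bigConj L)) := by
  induction L using bigConj.induct with
  | case1 => exact weaken (id _)
  | case2 A => exact h A (by simp)
  | case3 A L hL ih =>
    rw [bigConj.eq_3 _ _ hL]
    exact mp (mp (s _ _ _) ((h A (by simp)).trans (conjIntro _ _)))
      (ih fun G hG => h G (List.mem_cons_of_mem _ hG))

theorem bigDisj_intro {L : List (PropForm α)} {G : PropForm α} (hG : G ∈ L) :
    Deriv T (impl G (bigDisj L)) := by
  induction L using bigDisj.induct with
  | case1 => simp at hG
  | case2 A =>
    obtain rfl := List.mem_singleton.1 hG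
    exact id _
  | case3 A L hL ih =>
    rw [bigDisj.eq_3 _ _ hL]
    rcases List.mem_cons.1 hG with rfl | hG
    · exact disjIntroL _ _
    · exact (ih hG).trans (disjIntroR _ _)

theorem bigDisj_elim {L : List (PropForm α)} (h : ∀ G ∈ L, Deriv T (impl G C)) :
    Deriv T (impl (bigDisj L) C) := by
  induction L using bigDisj.induct with
  | case1 => exact falsElim _
  | case2 A => exact h A (by simp)
  | case3 A L hL ih =>
    rw [bigDisj.eq_3 _ _ hL]
    exact mp (mp (disjElim _ _ _) (h A (by simp)))
      (ih fun G hG => h G (List.mem_cons_of_mem _ hG))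

theorem negneg_intro (h : Deriv T A) : Deriv T (neg (neg A)) :=
  deduction (mp (ax (Set.mem_insert _ _)) (h.mono (Set.subset_insert _ _)))

theorem conj_neg (A : PropForm α) : Deriv T (neg (conj A (neg A))) :=
  mp (mp (s _ _ _) (conjElimR _ _)) (conjElimL _ _)

theorem curry (h : Deriv T (impl (conj A B) C)) : Deriv T (impl A (impl B C)) :=
  (conjIntro A B).trans (mp (s _ _ _) (weaken h))

theorem swap (h : Deriv T (impl A (impl B C))) : Deriv T (impl B (impl A C)) :=
  (k B A).trans (mp (s _ _ _) h)

end Deriv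

theorem iProves_iff_deriv {α : Type} {T : Set (PropForm α)} {F : PropForm α} :
    IProves T F ↔ Deriv T F := by
  constructor
  · rintro ⟨L, hL, h⟩
    refine .mp (Deriv.mono h (Set.empty_subset _)) (.mp (Deriv.bigConj_intro fun G hG => ?_)
      (Deriv.id fals))
    exact .weaken (.ax (hL G hG))
  · intro h
    obtain ⟨L, hL, h⟩ := h.exists_list
    refine ⟨L, hL, Deriv.deduction (h.cut fun G hG => ?_)⟩
    exact .mp (Deriv.bigConj_elim hG) (.ax (Set.mem_insert _ _))

namespace PropForm

variable {α : Type}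

/-- Simultaneous substitution of formulas for atoms. -/
def bind (θ : α → PropForm α) : PropForm α → PropForm α
  | var a => θ a
  | fals => fals
  | conj A B => conj (bind θ A) (bind θ B)
  | disj A B => disj (bind θ A) (bind θ B)
  | impl A B => impl (bind θ A) (bind θ B)

theorem bind_bigConj (θ : α → PropForm α) (L : List (PropForm α)) :
    bind θ (bigConj L) = bigConj (L.map (bind θ)) := by
  induction L using bigConj.induct with
  | case1 => rfl
  | case2 A => rfl
  | case3 A L hL ih =>
    rw [bigConj.eq_3 _ _ hL, bind, ih, List.map_cons, bigConj.eq_3 _ _ (by simpa using hL)]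

theorem bind_bigDisj (θ : α → PropForm α) (L : List (PropForm α)) :
    bind θ (bigDisj L) = bigDisj (L.map (bind θ)) := by
  induction L using bigDisj.induct with
  | case1 => rfl
  | case2 A => rfl
  | case3 A L hL ih =>
    rw [bigDisj.eq_3 _ _ hL, bind, ih, List.map_cons, bigDisj.eq_3 _ _ (by simpa using hL)]

end PropForm

theorem Deriv.bind {α : Type} {T U : Set (PropForm α)} {F : PropForm α} (θ : α → PropForm α)
    (h : Deriv T F) (hT : ∀ G ∈ T, Deriv U (G.bind θ)) : Deriv U (F.bind θ) := by
  induction h with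
  | ax h => exact hT _ h
  | mp _ _ ih₁ ih₂ => exact mp ih₁ ih₂
  | k => apply k
  | s => apply s
  | conjIntro => apply conjIntro
  | conjElimL => apply conjElimL
  | conjElimR => apply conjElimR
  | disjIntroL => apply disjIntroL
  | disjIntroR => apply disjIntroR
  | disjElim => apply disjElim
  | falsElim => apply falsElim

section FreeGen

variable {α : Type} {P : List (FClause α)} {φ : α → α} {a : α}

theorem mem_fSig_of_mem_head {c : FClause α} {l : α × Bool} (hc : c ∈ P) (hl : l ∈ c.head) :
    l.1 ∈ fSig P := ⟨c, hc, .inl ⟨l.2, hl⟩⟩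

theorem mem_fSig_of_mem_body {c : FClause α} {l : α × Bool} (hc : c ∈ P) (hl : l ∈ c.body) :
    l.1 ∈ fSig P := ⟨c, hc, .inr ⟨l.2, hl⟩⟩

theorem mem_fSig_of_mem_headNegs (ha : a ∈ headNegs P) : a ∈ fSig P := by
  simp only [headNegs, List.mem_flatMap, List.mem_filterMap] at ha
  obtain ⟨c, hc, l, hl, h⟩ := ha
  split_ifs at h
  obtain rfl := Option.some.inj h
  exact mem_fSig_of_mem_head hc hl

theorem delta_intro_mem (ha : a ∈ headNegs P) :
    ⟨[(φ a, true)], [(a, false)]⟩ ∈ freeGen P φ :=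
  List.mem_append_right _ (List.mem_flatMap.2 ⟨a, ha, by simp⟩)

theorem delta_excl_mem (ha : a ∈ headNegs P) :
    ⟨[], [(a, true), (φ a, true)]⟩ ∈ freeGen P φ :=
  List.mem_append_right _ (List.mem_flatMap.2 ⟨a, ha, by simp⟩)

theorem subst_mem {c : FClause α} (hc : c ∈ P) :
    c.subst {a | a ∈ headNegs P} φ ∈ freeGen P φ :=
  List.mem_append_left _ (List.mem_map_of_mem hc)

theorem mem_freeGen {c : FClause α} (hc : c ∈ freeGen P φ) :
    (∃ d ∈ P, d.subst {a | a ∈ headNegs P} φ = c) ∨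
      ∃ a ∈ headNegs P, c = ⟨[(φ a, true)], [(a, false)]⟩ ∨
        c = ⟨[], [(a, true), (φ a, true)]⟩ := by
  simpa [freeGen, deltaClauses] using hc

theorem substLit_eq_or (S : Set α) (φ : α → α) (l : α × Bool) :
    (∃ a ∈ S, l = (a, false) ∧ substLit S φ l = (φ a, true)) ∨ substLit S φ l = l := by
  obtain ⟨a, b⟩ := l
  by_cases h : b = false ∧ a ∈ S
  · obtain ⟨rfl, ha⟩ := h
    exact .inl ⟨a, ha, rfl, by simp [substLit, ha]⟩
  · exact .inr (if_neg h)

theorem fSig_subset_fSig_freeGen : fSig P ⊆ fSig (freeGen P φ) := by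
  rintro a ⟨c, hc, h⟩
  by_cases ha : a ∈ headNegs P
  · exact ⟨_, delta_intro_mem ha, .inr ⟨false, by simp⟩⟩
  · have hs : ∀ b, substLit {a | a ∈ headNegs P} φ (a, b) = (a, b) := fun b =>
      if_neg fun h => ha h.2
    refine ⟨_, subst_mem hc, h.imp ?_ ?_⟩ <;> rintro ⟨b, hb⟩ <;>
      exact ⟨b, List.mem_map.2 ⟨_, hb, hs b⟩⟩

theorem mem_fSig_freeGen (ha : a ∈ fSig (freeGen P φ)) :
    a ∈ fSig P ∨ ∃ b ∈ headNegs P, φ b = a := by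
  obtain ⟨c, hc, h⟩ := ha
  obtain ⟨d, hd, rfl⟩ | ⟨b, hb, rfl | rfl⟩ := mem_freeGen hc
  · have key : ∀ l : α × Bool, l.1 ∈ fSig P → ∀ v,
        substLit {a | a ∈ headNegs P} φ l = (a, v) → a ∈ fSig P ∨ ∃ b ∈ headNegs P, φ b = a := by
      intro l hl v hv
      obtain ⟨b, hb, -, h⟩ | h := substLit_eq_or {a | a ∈ headNegs P} φ l
      · exact .inr ⟨b, hb, congrArg Prod.fst (h.symm.trans hv)⟩
      · obtain rfl := h.symm.trans hv
        exact .inl hl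
    obtain ⟨v, hv⟩ | ⟨v, hv⟩ := h <;> obtain ⟨l, hl, h⟩ := List.mem_map.1 hv
    · exact key l (mem_fSig_of_mem_head hd hl) v h
    · exact key l (mem_fSig_of_mem_body hd hl) v h
  all_goals
    have := mem_fSig_of_mem_headNegs hb
    simp only [FClause.atomsF, Set.mem_ofPred_eq, List.mem_cons, List.not_mem_nil] at h
    grind

/-- In a theory containing `FreeGen(P)`, `φ a` is implied by `¬a`. -/
theorem deriv_reserved_of_neg {T : Set (PropForm α)} (hT : fTh (freeGen P φ) ⊆ T)
    (ha : a ∈ headNegs P) : Deriv T (impl (neg (var a)) (var (φ a))) :=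
  .ax (hT ⟨_, delta_intro_mem ha, rfl⟩)

/-- In a theory containing `FreeGen(P)`, `φ a` implies `¬a`. -/
theorem deriv_neg_of_reserved {T : Set (PropForm α)} (hT : fTh (freeGen P φ) ⊆ T)
    (ha : a ∈ headNegs P) : Deriv T (impl (var (φ a)) (neg (var a))) :=
  .swap (.curry (.ax (hT ⟨_, delta_excl_mem ha, rfl⟩)))

theorem deriv_lit_substLit {T : Set (PropForm α)} (hT : fTh (freeGen P φ) ⊆ T) (l : α × Bool) :
    Deriv T (impl (litToProp l) (litToProp (substLit {a | a ∈ headNegs P} φ l))) ∧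
      Deriv T (impl (litToProp (substLit {a | a ∈ headNegs P} φ l)) (litToProp l)) := by
  obtain ⟨a, ha, rfl, h⟩ | h := substLit_eq_or {a | a ∈ headNegs P} φ l
  · rw [h]
    exact ⟨deriv_reserved_of_neg hT ha, deriv_neg_of_reserved hT ha⟩
  · rw [h]
    exact ⟨.id _, .id _⟩

/-- `FreeGen(P)` proves every clause of `P`. -/
theorem deriv_clause_of_freeGen {T : Set (PropForm α)} (hT : fTh (freeGen P φ) ⊆ T)
    {c : FClause α} (hc : c ∈ P) : Deriv T c.toProp := by
  refine .trans (.bigConj_intro fun G hG => ?_)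
    (.trans (.ax (hT ⟨_, subst_mem hc, rfl⟩)) (.bigDisj_elim fun G hG => ?_))
  · simp only [FClause.subst, List.mem_map, exists_exists_and_eq_and] at hG
    obtain ⟨l, hl, rfl⟩ := hG
    exact .trans (.bigConj_elim (List.mem_map_of_mem hl)) (deriv_lit_substLit hT l).1
  · simp only [FClause.subst, List.mem_map, exists_exists_and_eq_and] at hG
    obtain ⟨l, hl, rfl⟩ := hG
    exact .trans (deriv_lit_substLit hT l).2 (.bigDisj_intro (List.mem_map_of_mem hl))

open scoped Classical in
/-- The substitution replacing each reserved atom `φ a` (`a ∈ S`) by `¬a`. -/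
noncomputable def unreserve (S : Set α) (φ : α → α) (b : α) : PropForm α :=
  if h : ∃ a ∈ S, φ a = b then neg (var h.choose) else var b

theorem unreserve_apply {S : Set α} (hinj : Set.InjOn φ S) (ha : a ∈ S) :
    unreserve S φ (φ a) = neg (var a) := by
  have h : ∃ a' ∈ S, φ a' = φ a := ⟨a, ha, rfl⟩
  rw [unreserve, dif_pos h, hinj h.choose_spec.1 ha h.choose_spec.2]

theorem unreserve_of_mem_fSig (hfresh : ∀ a ∈ headNegs P, φ a ∉ fSig P) (ha : a ∈ fSig P) :
    unreserve {a | a ∈ headNegs P} φ a = var a := by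
  refine dif_neg ?_
  rintro ⟨b, hb, rfl⟩
  exact hfresh b hb ha

theorem bind_unreserve_substLit (hinj : Set.InjOn φ {a | a ∈ headNegs P})
    (hfresh : ∀ a ∈ headNegs P, φ a ∉ fSig P) {l : α × Bool} (hl : l.1 ∈ fSig P) :
    (litToProp (substLit {a | a ∈ headNegs P} φ l)).bind (unreserve {a | a ∈ headNegs P} φ) =
      litToProp l := by
  obtain ⟨a, ha, rfl, h⟩ | h := substLit_eq_or {a | a ∈ headNegs P} φ l
  · rw [h]
    exact unreserve_apply hinj ha
  · rw [h]
    have := unreserve_of_mem_fSig hfresh hl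
    obtain ⟨a, _ | _⟩ := l <;> simp_all [litToProp, PropForm.bind, neg]

theorem bind_unreserve_subst (hinj : Set.InjOn φ {a | a ∈ headNegs P})
    (hfresh : ∀ a ∈ headNegs P, φ a ∉ fSig P) {c : FClause α} (hc : c ∈ P) :
    (c.subst {a | a ∈ headNegs P} φ).toProp.bind (unreserve {a | a ∈ headNegs P} φ) =
      c.toProp := by
  simp only [FClause.toProp, FClause.subst, PropForm.bind, bind_bigConj, bind_bigDisj,
    List.map_map]
  congr 2 <;> refine List.map_congr_left fun l hl => ?_
  · exact bind_unreserve_substLit hinj hfresh (mem_fSig_of_mem_body hc hl)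
  · exact bind_unreserve_substLit hinj hfresh (mem_fSig_of_mem_head hc hl)

theorem deriv_bind_freeGen (hinj : Set.InjOn φ {a | a ∈ headNegs P})
    (hfresh : ∀ a ∈ headNegs P, φ a ∉ fSig P) {U : Set (PropForm α)} (hU : fTh P ⊆ U)
    {F : PropForm α} (hF : F ∈ fTh (freeGen P φ)) :
    Deriv U (F.bind (unreserve {a | a ∈ headNegs P} φ)) := by
  obtain ⟨c, hc, rfl⟩ := hF
  obtain ⟨d, hd, rfl⟩ | ⟨a, ha, rfl | rfl⟩ := mem_freeGen hc
  · rw [bind_unreserve_subst hinj hfresh hd]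
    exact .ax (hU ⟨d, hd, rfl⟩)
  all_goals
    have h₁ := unreserve_apply hinj ha
    have h₂ := unreserve_of_mem_fSig hfresh (mem_fSig_of_mem_headNegs ha)
    simp only [FClause.toProp, List.map, litToProp, bigConj, bigDisj, PropForm.bind, neg, h₁, h₂]
  · exact .id _
  · exact .conj_neg _

end FreeGen

/-- for a free program `P`, `M ⊆ σ_P` and `M_S = M ∪ φ(S \ M)`,
`FreeGen(P) ∪ ¬(σ_{FreeGen(P)} \ M_S) ∪ ¬¬M_S ⊩_I M_S` iff
`P ∪ ¬(σ_P \ M) ∪ ¬¬M ⊩_I M`.  Here `S = headNegs P` is the set of atoms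
occurring negated in heads of `P` and `φ` maps `S` injectively to fresh
reserved atoms. -/
theorem freeGen_proves_iff {α : Type} (P : List (FClause α)) (φ : α → α)
    (M : Set α) (hM : M ⊆ fSig P)
    (hinj : Set.InjOn φ {a | a ∈ headNegs P})
    (hfresh : ∀ a ∈ headNegs P, φ a ∉ fSig P) :
    IProvesAll
        (fTh (freeGen P φ) ∪
          negSet (fSig (freeGen P φ) \ (M ∪ φ '' ({a | a ∈ headNegs P} \ M))) ∪
          negnegSet (M ∪ φ '' ({a | a ∈ headNegs P} \ M)))
        (M ∪ φ '' ({a | a ∈ headNegs P} \ M)) ↔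
      IProvesAll (fTh P ∪ negSet (fSig P \ M) ∪ negnegSet M) M := by
  set S := {a | a ∈ headNegs P}
  set T := fTh (freeGen P φ) ∪ negSet (fSig (freeGen P φ) \ (M ∪ φ '' (S \ M))) ∪
    negnegSet (M ∪ φ '' (S \ M))
  set U := fTh P ∪ negSet (fSig P \ M) ∪ negnegSet M
  have hfix : ∀ a ∈ fSig P, unreserve S φ a = var a := fun a => unreserve_of_mem_fSig hfresh
  have hres : ∀ a ∈ S, unreserve S φ (φ a) = neg (var a) := fun a => unreserve_apply hinj
  have hPT : fTh (freeGen P φ) ⊆ T := fun F hF => .inl (.inl hF)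
  have hneg : ∀ a ∈ fSig P, a ∉ M → neg (var a) ∈ T := by
    refine fun a ha haM => .inl (.inr ⟨a, ⟨fSig_subset_fSig_freeGen ha, ?_⟩, rfl⟩)
    rintro (h | ⟨b, hb, rfl⟩)
    exacts [haM h, hfresh b hb.1 ha]
  have hUT : ∀ F, Deriv U F → Deriv T F := by
    refine fun F hF => hF.cut ?_
    rintro G ((⟨c, hc, rfl⟩ | ⟨a, ha, rfl⟩) | ⟨a, ha, rfl⟩)
    · exact deriv_clause_of_freeGen hPT hc
    · exact .ax (hneg a ha.1 ha.2)
    · exact .ax (.inr ⟨a, .inl ha, rfl⟩)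
  have hTU : ∀ F, Deriv T F → Deriv U (F.bind (unreserve S φ)) := by
    refine fun F hF => hF.bind _ ?_
    rintro G ((hG | ⟨a, ⟨ha, haM⟩, rfl⟩) | ⟨a, ha | ⟨a, ha, rfl⟩, rfl⟩)
    · exact deriv_bind_freeGen hinj hfresh (fun F hF => .inl (.inl hF)) hG
    · obtain ha | ⟨b, hb, rfl⟩ := mem_fSig_freeGen ha
      · simp only [neg, PropForm.bind, hfix a ha]
        exact .ax (.inl (.inr ⟨a, ⟨ha, fun h => haM (.inl h)⟩, rfl⟩))
      · simp only [neg, PropForm.bind, hres b hb]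
        have hbM : b ∈ M := by
          by_contra h
          exact haM (.inr ⟨b, ⟨hb, h⟩, rfl⟩)
        exact .ax (.inr ⟨b, hbM, rfl⟩)
    · simp only [neg, PropForm.bind, hfix a (hM ha)]
      exact .ax (.inr ⟨a, ha, rfl⟩)
    · simp only [neg, PropForm.bind, hres a ha.1]
      exact .negneg_intro
        (.ax (.inl (.inr ⟨a, ⟨mem_fSig_of_mem_headNegs ha.1, ha.2⟩, rfl⟩)))
  simp only [IProvesAll, IConsistent, iProves_iff_deriv]
  refine and_congr (not_congr ⟨hTU fals, hUT fals⟩) ⟨fun h a ha => ?_, ?_⟩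
  · have := hTU _ (h a (.inl ha))
    rwa [PropForm.bind, hfix a (hM ha)] at this
  · rintro h _ (ha | ⟨a, ⟨ha, haM⟩, rfl⟩)
    · exact hUT _ (h _ ha)
    · exact .mp (deriv_reserved_of_neg hPT ha)
        (.ax (hneg a (mem_fSig_of_mem_headNegs ha) haM))

end ASP
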